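/- Let (X,d) be a metric space, Y a paracompact Hausdorff C-space, and f : X → Y an open continuous surjection such that each fiber f⁻¹(y) is dense in itself (has no isolated points) and d-complete. Let U ⊂ X be an open section for f. Then there exist a continuous surjective map g : X → Y × [0,1], a closed section H ⊂ X for f with H ⊂ U, and a subset 𝔠 ⊂ [0,1] homeomorphic to the Cantor set such that: (a) f = P_Y ∘ g, where P_Y : Y × [0,1] → Y is the projection; (b) g(H) = Y × [0,1], and for each (y,c) ∈ Y × 𝔠 the set g⁻¹(y,c) ∩ H is compact and zero-dimensional. In particular, H_𝔠 = H ∩ g⁻¹(Y × 𝔠) is a closed section for f such that the restriction f↾H_𝔠 is a compact light map. -/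

import Mathlib

open Set Topology Filter

/-- A topological space `Y` is a C-space if for every sequence of open covers `W n`
there is a sequence `V n` of pairwise disjoint open families such that each `V n`
refines `W n` and the union of all `V n` is a cover. -/
def IsCSpace (Y : Type*) [TopologicalSpace Y] : Prop :=
  ∀ W : ℕ → Set (Set Y),
    (∀ n, (∀ U ∈ W n, IsOpen U) ∧ ⋃₀ W n = Set.univ) →
    ∃ V : ℕ → Set (Set Y),
      (∀ n, (∀ U ∈ V n, IsOpen U) ∧ (V n).Pairwise Disjoint ∧
        ∀ U ∈ V n, ∃ W' ∈ W n, U ⊆ W') ∧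
      ⋃₀ (⋃ n, V n) = Set.univ

/-- A subset `A ⊆ X` is C*-embedded if every bounded continuous real-valued
function on `A` extends continuously to `X`. -/
def CStarEmbedded {X : Type*} [TopologicalSpace X] (A : Set X) : Prop :=
  ∀ g : C(A, ℝ), (∃ M : ℝ, ∀ a : A, |g a| ≤ M) →
    ∃ G : C(X, ℝ), ∀ a : A, G a = g a

/-- A space has covering dimension zero: every finite open cover admits a finite
refinement by pairwise disjoint open sets covering the space. -/
def CovDimZero (Z : Type*) [TopologicalSpace Z] : Prop :=
  ∀ 𝒰 : Finset (Set Z), (∀ U ∈ 𝒰, IsOpen U) → ⋃₀ (𝒰 : Set (Set Z)) = Set.univ →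
    ∃ 𝒱 : Finset (Set Z), (∀ V ∈ 𝒱, IsOpen V) ∧ Set.Pairwise {V : Set Z | V ∈ 𝒱} Disjoint ∧
      (∀ V ∈ 𝒱, ∃ U ∈ 𝒰, V ⊆ U) ∧ ⋃₀ (𝒱 : Set (Set Z)) = Set.univ


open TopologicalSpace in
lemma covDimZero_of_compact {X : Type*} [TopologicalSpace X] [T2Space X] {K : Set X}
    (hK : IsCompact K) (ht : IsTotallyDisconnected K) : CovDimZero ↥K := by
  classical
  have : CompactSpace K := isCompact_iff_compactSpace.mp hK
  have : TotallyDisconnectedSpace K := by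
    rw [totallyDisconnectedSpace_subtype_iff]; exact ht
  intro 𝒰 ho hc
  let O : {u // u ∈ 𝒰} → Opens K := fun u => ⟨u.1, ho u.1 u.2⟩
  have hO : IsOpenCover O := by
    refine IsOpenCover.of_sets (v := fun u : {u // u ∈ 𝒰} => u.1) (fun u => ho u.1 u.2) ?_
    rw [← hc, Set.sUnion_eq_iUnion]
    rfl
  obtain ⟨n, W, h1, h2, h3⟩ := hO.exists_finite_nonempty_disjoint_clopen_cover
  refine ⟨Finset.univ.image (fun j => (W j : Set K)), ?_, ?_, ?_, ?_⟩
  · intro V hV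
    obtain ⟨j, -, rfl⟩ := Finset.mem_image.mp hV
    exact (W j).isClopen.isOpen
  · intro V hV V' hV' hne
    obtain ⟨j, -, rfl⟩ := Finset.mem_image.mp (mem_ofPred.mp hV)
    obtain ⟨j', -, rfl⟩ := Finset.mem_image.mp (mem_ofPred.mp hV')
    have : j ≠ j' := by rintro rfl; exact hne rfl
    exact Clopens.coe_disjoint.mpr (h3 this)
  · intro V hV
    obtain ⟨j, -, rfl⟩ := Finset.mem_image.mp hV
    obtain ⟨i, hi⟩ := (h1 j).2
    exact ⟨i.1, i.2, hi⟩
  · apply Set.eq_univ_of_univ_subset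
    intro x hx
    obtain ⟨j, hj⟩ := mem_iUnion.mp (h2 hx)
    exact ⟨_, by simp, hj⟩

/-- Finite family of sets of diameter at most `ε`, covering `K`. -/
lemma ultrafilter_conv {X : Type*} [MetricSpace X] (𝒰 : Ultrafilter X) (F : Set X)
    (hF : IsComplete F) (hFU : F ∈ 𝒰)
    (h : ∀ ε > 0, ∃ 𝒟 : Set (Set X), 𝒟.Finite ∧ (∀ D ∈ 𝒟, ∀ a ∈ D, ∀ b ∈ D, dist a b ≤ ε) ∧
      ⋃₀ 𝒟 ∈ 𝒰) : ∃ x ∈ F, (𝒰 : Filter X) ≤ 𝓝 x := by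
  refine hF 𝒰 ?_ (by simpa using hFU)
  rw [Metric.cauchy_iff]
  refine ⟨inferInstance, fun ε hε => ?_⟩
  obtain ⟨𝒟, h1, h2, h3⟩ := h (ε / 2) (half_pos hε)
  obtain ⟨D, hD, hDU⟩ := (Ultrafilter.finite_sUnion_mem_iff h1).mp h3
  exact ⟨D, hDU, fun a ha b hb => (h2 D hD a ha b hb).trans_lt (half_lt_self hε)⟩

lemma preconn_finite {X : Type*} [TopologicalSpace X] {t : Set X} (ht : IsPreconnected t)
    (hne : t.Nonempty) {ι : Type*} (s : Set ι) (D : ι → Set X) (hs : s.Finite)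
    (hc : ∀ D' ∈ s, IsClosed (D D')) (hd : s.Pairwise (fun a b => Disjoint (D a) (D b)))
    (hcov : t ⊆ ⋃ i ∈ s, D i) :
    ∃ i ∈ s, t ⊆ D i := by
  obtain ⟨x, hx⟩ := hne
  obtain ⟨i, hi, hxi⟩ := mem_iUnion₂.mp (hcov hx)
  refine ⟨i, hi, ?_⟩
  have hcl : IsClosed (⋃ j ∈ s \ {i}, D j) :=
    (hs.subset sdiff_subset).isClosed_biUnion (fun j hj => hc j hj.1)
  have hdis : Disjoint (D i) (⋃ j ∈ s \ {i}, D j) := by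
    rw [Set.disjoint_iUnion₂_right]
    intro j hj
    exact hd hi hj.1 (fun h => hj.2 h.symm)
  have hcov' : t ⊆ D i ∪ ⋃ j ∈ s \ {i}, D j := by
    intro z hz
    obtain ⟨j, hj, hzj⟩ := mem_iUnion₂.mp (hcov hz)
    by_cases hji : j = i
    · left; rw [← hji]; exact hzj
    · right; exact mem_iUnion₂.mpr ⟨j, ⟨hj, hji⟩, hzj⟩
  rcases (isPreconnected_iff_subset_of_disjoint_closed.mp ht) (D i) _ (hc i hi) hcl hcov'
    (by rw [hdis.inter_eq, inter_empty]) with h | h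
  · exact h
  · exact absurd (h hx) (Set.disjoint_left.mp hdis hxi)

/-- `w` is not constant on the part of the fiber over `y` lying in `U`. -/
def NC {X Y : Type*} (f : X → Y) (U : Set X) (w : X → ℝ) (y : Y) : Prop :=
  ∃ x ∈ U, ∃ x' ∈ U, f x = y ∧ f x' = y ∧ w x ≠ w x'

open BoundedContinuousFunction in
lemma nc_open {X Y : Type*} [MetricSpace X] [TopologicalSpace Y] (f : X → Y)
    (hopen : IsOpenMap f) (U : Set X) (hU : IsOpen U) (T : Set (X →ᵇ ℝ)) (hT : T.Finite) :
    IsOpen {y | ∀ w ∈ convexHull ℝ T, NC f U w y} := by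
  rw [isOpen_iff_mem_nhds]
  intro y hy
  refine (hT.isCompact_convexHull ℝ).eventually_forall_of_forall_eventually
    (P := fun y w => NC f U w y) ?_
  intro w hw
  obtain ⟨x, hx, x', hx', hfx, hfx', hne⟩ := hy w hw
  have hd : 0 < |w x - w x'| := abs_pos.mpr (sub_ne_zero.mpr hne)
  set ε := |w x - w x'| / 4 with hε
  have hεpos : 0 < ε := by positivity
  have hop : ∀ a ∈ U, f a = y → ∀ᶠ y' in 𝓝 y, ∃ b ∈ U, f b = y' ∧ |w b - w a| < ε := by
    intro a ha hfa
    have h1 : IsOpen (U ∩ {b | |w b - w a| < ε}) := by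
      refine hU.inter (isOpen_lt ?_ continuous_const)
      have := w.continuous
      fun_prop
    have h2 := (hopen _ h1).mem_nhds (x := y) ⟨a, ⟨ha, by simpa using hεpos⟩, hfa⟩
    filter_upwards [h2] with y' hy'
    obtain ⟨b, hb, hfb⟩ := hy'
    exact ⟨b, hb.1, hfb, hb.2⟩
  have h3 : ∀ᶠ w' in 𝓝 w, dist w' w < ε := Metric.ball_mem_nhds w hεpos
  have h4 := ((hop x hx hfx).and (hop x' hx' hfx')).prod_nhds h3
  filter_upwards [h4] with z hz
  obtain ⟨⟨⟨b, hb, hfb, hwb⟩, b', hb', hfb', hwb'⟩, hw'⟩ := hz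
  refine ⟨b, hb, b', hb', hfb, hfb', fun heq => ?_⟩
  have e1 := (dist_coe_le_dist (f := z.2) (g := w) b).trans_lt hw'
  have e2 := (dist_coe_le_dist (f := z.2) (g := w) b').trans_lt hw'
  rw [Real.dist_eq] at e1 e2
  rw [heq] at e1
  have : |w x - w x'| < 4 * ε := by
    rw [abs_lt] at *
    constructor <;> linarith
  rw [hε] at this
  linarith

open BoundedContinuousFunction in
lemma exists_new {X : Type*} [MetricSpace X] (T : Set (X →ᵇ ℝ)) (hT : T.Finite)
    (F : Set X) (hF : F.Infinite) :
    ∃ v : X →ᵇ ℝ, ∀ w ∈ Submodule.span ℝ T, ∃ x ∈ F, ∃ x' ∈ F, (v - w) x ≠ (v - w) x' := by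
  classical
  set k := hT.toFinset.card with hk
  obtain ⟨P, hPF, hPc⟩ := hF.exists_subset_card_eq (k + 2)
  let R : (X →ᵇ ℝ) →ₗ[ℝ] (P → ℝ) :=
    { toFun := fun v p => v p
      map_add' := fun _ _ => rfl
      map_smul' := fun _ _ => rfl }
  let T' : Finset (P → ℝ) := insert (fun _ => 1) (hT.toFinset.image R)
  have hT'c : T'.card < k + 2 := by
    have h1 := Finset.card_insert_le (fun _ => (1 : ℝ)) (hT.toFinset.image R)
    have h2 : (hT.toFinset.image R).card ≤ k := Finset.card_image_le
    have : T'.card ≤ (hT.toFinset.image R).card + 1 := h1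
    omega
  have hne : Submodule.span ℝ (T' : Set (P → ℝ)) ≠ ⊤ := by
    intro h
    have h1 := finrank_span_finset_le_card (R := ℝ) T'
    rw [Set.finrank, h, finrank_top, Module.finrank_fintype_fun_eq_card, Fintype.card_coe, hPc] at h1
    omega
  obtain ⟨u, hu⟩ : ∃ u, u ∉ Submodule.span ℝ (T' : Set (P → ℝ)) := by
    by_contra! h
    exact hne (Submodule.eq_top_iff'.mpr h)
  have hemb : IsClosedEmbedding (Subtype.val : P → X) :=
    P.finite_toSet.isClosed.isClosedEmbedding_subtypeVal
  obtain ⟨v, -, hv⟩ := exists_extension_norm_eq_of_isClosedEmbedding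
    (BoundedContinuousFunction.ofNormedAddCommGroupDiscrete u ‖u‖ (fun p => norm_le_pi_norm u p)) hemb
  have hRv : R v = u := hv
  refine ⟨v, fun w hw => ?_⟩
  by_contra! h
  apply hu
  have hPne : P.Nonempty := by rw [← Finset.card_pos]; omega
  obtain ⟨p, hp⟩ := hPne
  have hc : R (v - w) = ((v - w) p) • (fun _ => (1 : ℝ)) := by
    ext q
    simp only [Pi.smul_apply, smul_eq_mul, mul_one]
    exact h q (hPF q.2) p (hPF hp)
  have hRw : R w ∈ Submodule.span ℝ (T' : Set (P → ℝ)) := by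
    have h1 : R w ∈ (Submodule.span ℝ T).map R := Submodule.mem_map_of_mem hw
    rw [Submodule.map_span] at h1
    refine Submodule.span_mono ?_ h1
    rintro _ ⟨t, ht, rfl⟩
    simp only [T', Finset.coe_insert, Finset.coe_image, Set.Finite.coe_toFinset]
    exact Or.inr ⟨t, ht, rfl⟩
  have : u = R (v - w) + R w := by rw [← map_add, sub_add_cancel, hRv]
  rw [this, hc]
  refine Submodule.add_mem _ (Submodule.smul_mem _ _ (Submodule.subset_span ?_)) hRw
  simp [T']

open BoundedContinuousFunction in
lemma nc_insert {X Y : Type*} [MetricSpace X] (f : X → Y) (U : Set X) (y : Y)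
    (T S : Set (X →ᵇ ℝ)) (hST : S ⊆ T) (v : X →ᵇ ℝ)
    (hv : ∀ w ∈ Submodule.span ℝ T, ∃ x ∈ U ∩ f ⁻¹' {y}, ∃ x' ∈ U ∩ f ⁻¹' {y},
      (v - w) x ≠ (v - w) x')
    (hS : ∀ w ∈ convexHull ℝ S, NC f U w y) :
    ∀ w ∈ convexHull ℝ (insert v S), NC f U w y := by
  have key : ∀ w ∈ Submodule.span ℝ T, NC f U (v - w : X →ᵇ ℝ) y := by
    intro w hw
    obtain ⟨x, hx, x', hx', hne⟩ := hv w hw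
    exact ⟨x, hx.1, x', hx'.1, hx.2, hx'.2, hne⟩
  intro w hw
  rcases S.eq_empty_or_nonempty with rfl | hne
  · simp only [insert_empty_eq, convexHull_singleton, mem_singleton_iff] at hw
    subst hw
    simpa using key 0 (Submodule.zero_mem _)
  · rw [convexHull_insert hne, mem_convexJoin] at hw
    obtain ⟨v', hv', s, hs, hw⟩ := hw
    rw [mem_singleton_iff] at hv'
    subst hv'
    obtain ⟨a, b, ha, hb, hab, rfl⟩ := hw
    by_cases ha0 : a = 0
    · have : b = 1 := by linarith
      subst ha0 this
      simpa using hS s hs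
    · have hsT : s ∈ Submodule.span ℝ T :=
        convexHull_min (hST.trans Submodule.subset_span) (Submodule.convex _) hs
      obtain ⟨x, hx, x', hx', h1, h2, h3⟩ := key ((-(b / a)) • s) (Submodule.smul_mem _ _ hsT)
      refine ⟨x, hx, x', hx', h1, h2, fun h => h3 ?_⟩
      simp only [coe_add, coe_smul, coe_sub, Pi.add_apply, Pi.sub_apply, smul_eq_mul] at h ⊢
      field_simp
      linarith

/-- Bookkeeping for the construction of the covers used in the splitting lemma. -/
def GoodState {X Y : Type*} [MetricSpace X] [TopologicalSpace Y] (f : X → Y) (U : Set X)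
    (A : Y → Set (Set (BoundedContinuousFunction X ℝ))) : Prop :=
  (∀ y, (A y).Finite) ∧
  (∀ y, ∀ S ∈ A y, S.Finite ∧ ∀ w ∈ convexHull ℝ S, NC f U w y) ∧
  ∀ y, ∀ᶠ y' in 𝓝 y, A y' ⊆ A y

/-- The next state. -/
def nextState {X Y : Type*} [MetricSpace X] [TopologicalSpace Y]
    (A : Y → Set (Set (BoundedContinuousFunction X ℝ))) (W : Y → Set Y)
    (v : Y → BoundedContinuousFunction X ℝ) : Y → Set (Set (BoundedContinuousFunction X ℝ)) :=
  fun y => {S' | ∃ S ∈ A y, ∃ z, y ∈ closure (W z) ∧ insert (v z) S = S'}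

lemma step_state {X Y : Type*} [MetricSpace X]
    [TopologicalSpace Y] [T2Space Y] [ParacompactSpace Y]
    (f : X → Y) (hopen : IsOpenMap f) (U : Set X) (hU : IsOpen U)
    (hinf : ∀ y, (U ∩ f ⁻¹' {y}).Infinite)
    (A : Y → Set (Set (BoundedContinuousFunction X ℝ))) (hA : GoodState f U A) :
    ∃ (W : Y → Set Y) (v : Y → BoundedContinuousFunction X ℝ),
      (∀ z, IsOpen (W z)) ∧ ⋃ z, W z = univ ∧ GoodState f U (nextState A W v) := by
  obtain ⟨h1, h2, h3⟩ := hA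
  have hT : ∀ z, (⋃₀ A z).Finite := fun z => (h1 z).sUnion (fun S hS => (h2 z S hS).1)
  choose v hv using fun z => exists_new (⋃₀ A z) (hT z) _ (hinf z)
  have hN : ∀ z, ∃ N : Set Y, IsOpen N ∧ z ∈ N ∧ ∀ y ∈ N, A y ⊆ A z ∧
      ∀ S ∈ A z, ∀ w ∈ convexHull ℝ (insert (v z) S), NC f U w y := by
    intro z
    have e1 : ∀ᶠ y in 𝓝 z, ∀ S ∈ A z, ∀ w ∈ convexHull ℝ (insert (v z) S), NC f U w y := by
      rw [Filter.eventually_all_finite (h1 z)]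
      intro S hS
      refine (nc_open f hopen U hU _ ((h2 z S hS).1.insert (v z))).mem_nhds ?_
      exact nc_insert f U z (⋃₀ A z) S (subset_sUnion_of_mem hS) (v z) (hv z) (h2 z S hS).2
    obtain ⟨N, hN, hNo, hzN⟩ := mem_nhds_iff.mp ((h3 z).and e1)
    exact ⟨N, hNo, hzN, fun y hy => hN hy⟩
  choose N hNo hzN hNp using hN
  obtain ⟨W', hW'o, hW'c, hW'l, hW'N⟩ := precise_refinement N hNo
    (eq_univ_of_forall fun z => mem_iUnion.mpr ⟨z, hzN z⟩)
  obtain ⟨W, hWc, hWo, hWW'⟩ := exists_iUnion_eq_closure_subset hW'o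
    (fun y => hW'l.point_finite y) hW'c
  have hWl : LocallyFinite (fun z => closure (W z)) := hW'l.subset hWW'
  refine ⟨W, v, hWo, hWc, ?_, ?_, ?_⟩
  · intro y
    refine ((h1 y).image2 (fun S z => insert (v z) S) (hWl.point_finite y)).subset ?_
    rintro _ ⟨S, hS, z, hz, rfl⟩
    exact ⟨S, hS, z, hz, rfl⟩
  · rintro y _ ⟨S, hS, z, hz, rfl⟩
    have hyN := hW'N z (hWW' z hz)
    exact ⟨(h2 y S hS).1.insert _, (hNp z y hyN).2 S ((hNp z y hyN).1 hS)⟩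
  · intro y
    filter_upwards [h3 y, hWl.eventually_subset (fun _ => isClosed_closure) y] with y' e1 e2
    rintro _ ⟨S, hS, z, hz, rfl⟩
    exact ⟨S, e1 hS, z, e2 hz, rfl⟩

open BoundedContinuousFunction in
lemma exists_nc {X Y : Type*} [MetricSpace X]
    [TopologicalSpace Y] [T2Space Y] [ParacompactSpace Y] (hY : IsCSpace Y)
    (f : X → Y) (hf : Continuous f) (hopen : IsOpenMap f) (U : Set X) (hU : IsOpen U)
    (hinf : ∀ y, (U ∩ f ⁻¹' {y}).Infinite) :
    ∃ h : X → ℝ, Continuous h ∧ ∀ y, NC f U h y := by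
  classical
  choose W v hWo hWc hG using fun A : {A // GoodState f U A} =>
    step_state f hopen U hU hinf A.1 A.2
  have h0 : GoodState f U (fun _ => {∅}) := by
    refine ⟨fun y => finite_singleton _, ?_, fun y => Eventually.of_forall fun _ => Subset.rfl⟩
    rintro y S rfl
    simp
  let A : ℕ → {A // GoodState f U A} := fun n =>
    Nat.rec ⟨_, h0⟩ (fun _ B => ⟨_, hG B⟩) n
  have hAs : ∀ n, (A (n + 1)).1 = nextState (A n).1 (W (A n)) (v (A n)) := fun n => rfl
  obtain ⟨V, hV, hVc⟩ := hY (fun n => range (W (A n))) (fun n =>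
    ⟨by rintro _ ⟨z, rfl⟩; exact hWo _ z, by rw [sUnion_range]; exact hWc _⟩)
  have hz : ∀ i : (Σ n, {V' // V' ∈ V n}), ∃ z, i.2.1 ⊆ W (A i.1) z := by
    intro i
    obtain ⟨_, ⟨z, rfl⟩, hz⟩ := (hV i.1).2.2 i.2.1 i.2.2
    exact ⟨z, hz⟩
  choose z hz using hz
  obtain ⟨p, hp⟩ := PartitionOfUnity.exists_isSubordinate (s := (univ : Set Y)) isClosed_univ
    (fun i : (Σ n, {V' // V' ∈ V n}) => i.2.1) (fun i => (hV i.1).1 _ i.2.2) (by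
      intro y _
      have : y ∈ ⋃₀ (⋃ n, V n) := by rw [hVc]; trivial
      obtain ⟨V', hV', hy⟩ := this
      obtain ⟨n, hn⟩ := mem_iUnion.mp hV'
      exact mem_iUnion.mpr ⟨⟨n, V', hn⟩, hy⟩)
  let vv : (Σ n, {V' // V' ∈ V n}) → X →ᵇ ℝ := fun i => v (A i.1) (z i)
  refine ⟨fun x => ∑ᶠ i, p i (f x) * vv i x, ?_, ?_⟩
  · refine continuous_finsum (fun i => ?_) ?_
    · exact ((p i).continuous.comp hf).mul (vv i).continuous
    · refine (p.locallyFinite.preimage_continuous hf).subset ?_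
      intro i x hx
      simp only [Function.mem_support, mem_preimage] at hx ⊢
      exact left_ne_zero_of_mul hx
  · intro y
    have hfin : {i | p i y ≠ 0}.Finite := p.locallyFinite.point_finite y
    have hyV : ∀ i, p i y ≠ 0 → y ∈ i.2.1 := fun i hi => hp i (subset_tsupport _ hi)
    have hc : ∀ n, ∃ c, y ∈ closure (W (A n) c) ∧
        ∀ i, i.1 = n → p i y ≠ 0 → vv i = v (A n) c := by
      intro n
      by_cases hex : ∃ i, i.1 = n ∧ p i y ≠ 0
      · obtain ⟨i, rfl, hi⟩ := hex
        refine ⟨z i, subset_closure (hz i (hyV i hi)), ?_⟩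
        rintro ⟨m, V', hV'⟩ hm hj
        obtain ⟨n, V'', hV''⟩ := i
        dsimp only at hm
        subst hm
        have : V' = V'' := by
          by_contra hne
          exact Set.disjoint_left.mp ((hV _).2.1 hV' hV'' hne) (hyV _ hj) (hyV _ hi)
        subst this
        rfl
      · have : y ∈ ⋃ c, W (A n) c := by rw [hWc]; trivial
        obtain ⟨c, hc⟩ := mem_iUnion.mp this
        exact ⟨c, subset_closure hc, fun i h1 h2 => absurd ⟨i, h1, h2⟩ hex⟩
    choose c hcW hcv using hc
    have hchain : ∀ N, (fun n => v (A n) (c n)) '' {n | n < N} ∈ (A N).1 y := by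
      intro N
      induction N with
      | zero =>
        simp only [Nat.not_lt_zero]
        show _ ∈ ({∅} : Set (Set (X →ᵇ ℝ)))
        simp
      | succ N ih =>
        rw [hAs]
        refine ⟨_, ih, c N, hcW N, ?_⟩
        rw [← image_insert_eq (f := fun n => v (A n) (c n))]
        congr 1
        ext m
        simp only [mem_insert_iff, mem_ofPred_eq]
        omega
    obtain ⟨N, hN⟩ := (hfin.image (fun i => i.1)).bddAbove
    have hmem : ∑ᶠ i, p i y • vv i ∈
        convexHull ℝ ((fun n => v (A n) (c n)) '' {n | n < N + 1}) := by
      refine p.finsum_smul_mem_convex (g := fun i _ => vv i) (mem_univ y) ?_ (convex_convexHull _ _)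
      intro i hi
      refine subset_convexHull _ _ ⟨i.1, ?_, (hcv i.1 i rfl hi).symm⟩
      have : i.1 ≤ N := hN ⟨i, hi, rfl⟩
      exact Nat.lt_succ_of_le this
    obtain ⟨x, hx, x', hx', hfx, hfx', hne⟩ := ((A (N + 1)).2.2.1 y _ (hchain (N + 1))).2 _ hmem
    refine ⟨x, hx, x', hx', hfx, hfx', ?_⟩
    have hev : ∀ a, f a = y → ∑ᶠ i, p i (f a) * vv i a = (∑ᶠ i, p i y • vv i) a := by
      intro a ha
      rw [ha]
      have hs1 : (Function.support fun i => p i y • vv i) ⊆ hfin.toFinset := by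
        intro i hi
        simp only [Function.mem_support] at hi
        simp only [Set.Finite.coe_toFinset, mem_ofPred_eq]
        intro h0; rw [h0, zero_smul] at hi; exact hi rfl
      have hs2 : (Function.support fun i => p i y * vv i a) ⊆ hfin.toFinset := by
        intro i hi
        simp only [Function.mem_support] at hi
        simp only [Set.Finite.coe_toFinset, mem_ofPred_eq]
        exact left_ne_zero_of_mul hi
      rw [finsum_eq_sum_of_support_subset _ hs1, finsum_eq_sum_of_support_subset _ hs2]
      simp [BoundedContinuousFunction.coe_sum]
    beta_reduce
    rw [hev x hfx, hev x' hfx']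
    exact hne

lemma split_section {X Y : Type*} [MetricSpace X]
    [TopologicalSpace Y] [T2Space Y] [ParacompactSpace Y] (hY : IsCSpace Y)
    (f : X → Y) (hf : Continuous f) (hopen : IsOpenMap f)
    (hdense : ∀ y : Y, ∀ x ∈ f ⁻¹' {y}, AccPt x (𝓟 (f ⁻¹' {y})))
    (U : Set X) (hU : IsOpen U) (hUsec : f '' U = Set.univ) :
    ∃ A B : Set X, (IsOpen A ∧ f '' A = univ) ∧ (IsOpen B ∧ f '' B = univ) ∧
      A ⊆ U ∧ B ⊆ U ∧ Disjoint A B := by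
  have hinf : ∀ y, (U ∩ f ⁻¹' {y}).Infinite := by
    intro y
    have : y ∈ f '' U := by rw [hUsec]; trivial
    obtain ⟨x, hx, hxy⟩ := this
    have h1 := hdense y x hxy
    rw [accPt_iff_frequently_nhdsNE] at h1
    have h2 : ∃ᶠ z in 𝓝[≠] x, z ∈ U ∩ f ⁻¹' {y} :=
      (h1.and_eventually (mem_nhdsWithin_of_mem_nhds (hU.mem_nhds hx))).mono
        fun z hz => ⟨hz.2, hz.1⟩
    intro hfin
    refine h2 ?_
    have h4 := (hfin.subset (sdiff_subset (t := {x}))).isClosed.isOpen_compl.mem_nhds (x := x)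
      (by simp)
    filter_upwards [mem_nhdsWithin_of_mem_nhds h4, self_mem_nhdsWithin] with z hz1 hz2 hz3
    exact hz1 ⟨hz3, hz2⟩
  obtain ⟨h, hh, hnc⟩ := exists_nc hY f hf hopen U hU hinf
  obtain ⟨α, hα⟩ := exists_continuous_forall_mem_convex_of_local_const
    (t := fun y => {a : ℝ | (∃ x ∈ U, f x = y ∧ h x < a) ∧ ∃ x ∈ U, f x = y ∧ a < h x}) (by
      intro y
      rw [convex_iff_ordConnected]
      refine ⟨?_⟩
      rintro a ⟨⟨x, hx, hxy, hxa⟩, -⟩ b ⟨-, ⟨x', hx', hxy', hxb⟩⟩ c hc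
      exact ⟨⟨x, hx, hxy, hxa.trans_le hc.1⟩, ⟨x', hx', hxy', hc.2.trans_lt hxb⟩⟩) (by
      intro y
      have : ∃ x ∈ U, ∃ x' ∈ U, f x = y ∧ f x' = y ∧ h x < h x' := by
        obtain ⟨x, hx, x', hx', h1, h2, h3⟩ := hnc y
        rcases lt_or_gt_of_ne h3 with h4 | h4
        · exact ⟨x, hx, x', hx', h1, h2, h4⟩
        · exact ⟨x', hx', x, hx, h2, h1, h4⟩
      obtain ⟨x, hx, x', hx', h1, h2, h3⟩ := this
      obtain ⟨c, hc1, hc2⟩ := exists_between h3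
      refine ⟨c, ?_⟩
      have e1 := (hopen _ (hU.inter (isOpen_lt hh continuous_const))).mem_nhds
        (x := y) ⟨x, ⟨hx, hc1⟩, h1⟩
      have e2 := (hopen _ (hU.inter (isOpen_lt continuous_const hh))).mem_nhds
        (x := y) ⟨x', ⟨hx', hc2⟩, h2⟩
      filter_upwards [e1, e2] with y' hy1 hy2
      obtain ⟨a, ha, hfa⟩ := hy1
      obtain ⟨b, hb, hfb⟩ := hy2
      exact ⟨⟨a, ha.1, hfa, ha.2⟩, ⟨b, hb.1, hfb, hb.2⟩⟩)
  refine ⟨U ∩ {x | h x < α (f x)}, U ∩ {x | α (f x) < h x}, ⟨?_, ?_⟩, ⟨?_, ?_⟩,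
    inter_subset_left, inter_subset_left, ?_⟩
  · exact hU.inter (isOpen_lt hh (α.continuous.comp hf))
  · refine eq_univ_of_forall fun y => ?_
    obtain ⟨⟨x, hx, rfl, hxa⟩, -⟩ := hα y
    exact ⟨x, ⟨hx, hxa⟩, rfl⟩
  · exact hU.inter (isOpen_lt (α.continuous.comp hf) hh)
  · refine eq_univ_of_forall fun y => ?_
    obtain ⟨-, ⟨x, hx, rfl, hxa⟩⟩ := hα y
    exact ⟨x, ⟨hx, hxa⟩, rfl⟩
  · rw [Set.disjoint_left]
    intro x h1 h2
    exact lt_asymm (mem_ofPred.mp h1.2) (mem_ofPred.mp h2.2)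

/-- Closed disjoint finite small cover of the fiber parts of `K`. -/
def SmallFib {X Y : Type*} [MetricSpace X] (f : X → Y) (K : Set X) (ε : ℝ) : Prop :=
  ∀ y, ∃ 𝒟 : Set (Set X), 𝒟.Finite ∧ (∀ D ∈ 𝒟, IsClosed D) ∧ 𝒟.Pairwise Disjoint ∧
    (∀ D ∈ 𝒟, ∀ a ∈ D, ∀ b ∈ D, dist a b ≤ ε) ∧ K ∩ f ⁻¹' {y} ⊆ ⋃₀ 𝒟

lemma small_section {X Y : Type*} [MetricSpace X]
    [TopologicalSpace Y] [T2Space Y] [ParacompactSpace Y] (hY : IsCSpace Y)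
    (f : X → Y) (hf : Continuous f) (hopen : IsOpenMap f)
    (hdense : ∀ y : Y, ∀ x ∈ f ⁻¹' {y}, AccPt x (𝓟 (f ⁻¹' {y})))
    (U : Set X) (hU : IsOpen U ∧ f '' U = Set.univ) (ε : ℝ) (hε : 0 < ε) :
    ∃ A : Set X, (IsOpen A ∧ f '' A = univ) ∧ closure A ⊆ U ∧ SmallFib f (closure A) ε := by
  classical
  choose P Q hP hQ hPU hQU hPQ using fun V : {V : Set X // IsOpen V ∧ f '' V = univ} =>
    split_section hY f hf hopen hdense V.1 V.2.1 V.2.2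
  let R : ℕ → {V : Set X // IsOpen V ∧ f '' V = univ} := fun n =>
    Nat.rec ⟨U, hU⟩ (fun _ B => ⟨Q B, hQ B⟩) n
  have hRs : ∀ n, (R (n + 1)).1 = Q (R n) := fun n => rfl
  have hRanti : Antitone (fun n => (R n).1) :=
    antitone_nat_of_succ_le fun n => by
      rw [hRs]; exact hQU (R n)
  let O : ℕ → Set X := fun n => P (R n)
  have hOU : ∀ n, O n ⊆ U := fun n => (hPU (R n)).trans (hRanti (Nat.zero_le n))
  have hOd : ∀ m n, m < n → Disjoint (O m) (O n) := by
    intro m n hmn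
    refine (hPQ (R m)).mono_right ?_
    exact (hPU (R n)).trans (hRanti (Nat.succ_le_of_lt hmn))
  have hOd' : ∀ m n, m ≠ n → Disjoint (O m) (O n) := by
    intro m n hmn
    rcases lt_or_gt_of_ne hmn with h | h
    · exact hOd m n h
    · exact (hOd n m h).symm
  obtain ⟨V, hV, hVc⟩ := hY (fun n => {W | IsOpen W ∧ ∃ B : Set X, IsOpen B ∧ W ⊆ f '' B ∧
      closure B ⊆ O n ∧ ∀ a ∈ closure B, ∀ b ∈ closure B, dist a b ≤ ε}) (fun n => by
    refine ⟨fun W hW => hW.1, eq_univ_of_forall fun y => ?_⟩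
    have : y ∈ f '' (O n) := by rw [(hP (R n)).2]; trivial
    obtain ⟨x, hx, rfl⟩ := this
    obtain ⟨δ, hδ, hball⟩ := Metric.isOpen_iff.mp (hP (R n)).1 x hx
    have hm : 0 < min (δ / 2) (ε / 2) := by positivity
    refine ⟨f '' Metric.ball x (min (δ / 2) (ε / 2)), ⟨hopen _ Metric.isOpen_ball, _,
      Metric.isOpen_ball, Subset.rfl, ?_, ?_⟩, ⟨x, Metric.mem_ball_self hm, rfl⟩⟩
    · refine Metric.closure_ball_subset_closedBall.trans
        ((Metric.closedBall_subset_ball ?_).trans hball)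
      exact (min_le_left _ _).trans_lt (half_lt_self hδ)
    · intro a ha b hb
      have ha' := Metric.mem_closedBall.mp (Metric.closure_ball_subset_closedBall ha)
      have hb' := Metric.mem_closedBall.mp (Metric.closure_ball_subset_closedBall hb)
      have h3 := min_le_right (δ / 2) (ε / 2)
      have := dist_triangle_right a b x
      linarith)
  have hB : ∀ i : (Σ n, {V' // V' ∈ V n}), ∃ B : Set X, IsOpen B ∧ i.2.1 ⊆ f '' B ∧
      closure B ⊆ O i.1 ∧ ∀ a ∈ closure B, ∀ b ∈ closure B, dist a b ≤ ε := by
    intro i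
    obtain ⟨W, ⟨-, B, h1, h2, h3⟩, hVW⟩ := (hV i.1).2.2 i.2.1 i.2.2
    exact ⟨B, h1, hVW.trans h2, h3⟩
  choose B hBo hBV hBO hBε using hB
  obtain ⟨p, hp⟩ := PartitionOfUnity.exists_isSubordinate (s := (univ : Set Y)) isClosed_univ
    (fun i : (Σ n, {V' // V' ∈ V n}) => i.2.1) (fun i => (hV i.1).1 _ i.2.2) (by
      intro y _
      have : y ∈ ⋃₀ (⋃ n, V n) := by rw [hVc]; trivial
      obtain ⟨V', hV', hy⟩ := this
      obtain ⟨n, hn⟩ := mem_iUnion.mp hV'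
      exact mem_iUnion.mpr ⟨⟨n, V', hn⟩, hy⟩)
  let D : (Σ n, {V' // V' ∈ V n}) → Set X := fun i => B i ∩ f ⁻¹' (Function.support (p i))
  have hDlf : LocallyFinite D :=
    (p.locallyFinite.preimage_continuous hf).subset fun i => inter_subset_right
  have hDB : ∀ i, closure (D i) ⊆ closure (B i) := fun i => closure_mono inter_subset_left
  have hDV : ∀ i, closure (D i) ⊆ f ⁻¹' (tsupport (p i)) := fun i =>
    closure_minimal (inter_subset_right.trans (preimage_mono (subset_tsupport _)))
      ((isClosed_tsupport _).preimage hf)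
  have hdis : ∀ i j, i ≠ j → Disjoint (closure (D i)) (closure (D j)) := by
    rintro ⟨m, V', hV'⟩ ⟨n, V'', hV''⟩ hij
    by_cases hmn : m = n
    · subst hmn
      have hne : V' ≠ V'' := by rintro rfl; exact hij rfl
      rw [Set.disjoint_left]
      intro x hx hx'
      exact Set.disjoint_left.mp ((hV m).2.1 hV' hV'' hne) (hp _ (hDV _ hx)) (hp _ (hDV _ hx'))
    · exact (hOd' m n hmn).mono ((hDB _).trans (hBO _)) ((hDB _).trans (hBO _))
  refine ⟨⋃ i, D i, ⟨isOpen_iUnion fun i => ?_, eq_univ_of_forall fun y => ?_⟩, ?_, ?_⟩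
  · exact (hBo i).inter (((p i).continuous.isOpen_support).preimage hf)
  · obtain ⟨i, hi⟩ := p.exists_pos (mem_univ y)
    obtain ⟨x, hx, hxy⟩ := hBV i (hp i (subset_tsupport _ hi.ne'))
    refine ⟨x, mem_iUnion.mpr ⟨i, hx, ?_⟩, hxy⟩
    rw [mem_preimage, hxy]
    exact hi.ne'
  · rw [hDlf.closure_iUnion]
    exact iUnion_subset fun i => (hDB i).trans ((hBO i).trans (hOU _))
  · intro y
    have hfin : {i | y ∈ tsupport (p i)}.Finite := p.locallyFinite.closure.point_finite y
    refine ⟨(fun i => closure (D i)) '' {i | y ∈ tsupport (p i)}, hfin.image _, ?_, ?_, ?_, ?_⟩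
    · rintro _ ⟨i, -, rfl⟩; exact isClosed_closure
    · rintro _ ⟨i, -, rfl⟩ _ ⟨j, -, rfl⟩ hne
      exact hdis i j (by rintro rfl; exact hne rfl)
    · rintro _ ⟨i, -, rfl⟩ a ha b hb
      exact hBε i a (hDB i ha) b (hDB i hb)
    · rw [hDlf.closure_iUnion]
      rintro x ⟨hx, hxy⟩
      obtain ⟨i, hi⟩ := mem_iUnion.mp hx
      refine ⟨closure (D i), ⟨i, ?_, rfl⟩, hi⟩
      have := hDV i hi
      rw [mem_preimage, mem_singleton_iff.mp hxy] at this
      exact this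

lemma split_small {X Y : Type*} [MetricSpace X]
    [TopologicalSpace Y] [T2Space Y] [ParacompactSpace Y] (hY : IsCSpace Y)
    (f : X → Y) (hf : Continuous f) (hopen : IsOpenMap f)
    (hdense : ∀ y : Y, ∀ x ∈ f ⁻¹' {y}, AccPt x (𝓟 (f ⁻¹' {y})))
    (ε : ℝ) (hε : 0 < ε)
    (U : Set X) (hU : IsOpen U ∧ f '' U = Set.univ) :
    ∃ A : Bool → Set X, (∀ b, IsOpen (A b) ∧ f '' (A b) = univ) ∧ (∀ b, closure (A b) ⊆ U) ∧
      (∀ b, SmallFib f (closure (A b)) ε) ∧ Disjoint (closure (A false)) (closure (A true)) := by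
  obtain ⟨P, Q, hP, hQ, hPU, hQU, hd⟩ := split_section hY f hf hopen hdense U hU.1 hU.2
  obtain ⟨P', h1, h2, h3⟩ := small_section hY f hf hopen hdense P hP ε hε
  obtain ⟨Q', k1, k2, k3⟩ := small_section hY f hf hopen hdense Q hQ ε hε
  refine ⟨fun b => cond b Q' P', ?_, ?_, ?_, ?_⟩
  · rintro (_ | _); exacts [h1, k1]
  · rintro (_ | _); exacts [h2.trans hPU, k2.trans hQU]
  · rintro (_ | _); exacts [h3, k3]
  · exact hd.mono h2 k2

lemma exists_tree {X Y : Type*} [MetricSpace X]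
    [TopologicalSpace Y] [T2Space Y] [ParacompactSpace Y] (hY : IsCSpace Y)
    (f : X → Y) (hf : Continuous f) (hopen : IsOpenMap f)
    (hdense : ∀ y : Y, ∀ x ∈ f ⁻¹' {y}, AccPt x (𝓟 (f ⁻¹' {y})))
    (U : Set X) (hU : IsOpen U ∧ f '' U = Set.univ) :
    ∃ T : List Bool → Set X, T [] = U ∧ (∀ s, f '' (T s) = univ) ∧
      (∀ b s, closure (T (b :: s)) ⊆ T s) ∧
      (∀ b s, SmallFib f (closure (T (b :: s))) (1 / ((s.length : ℝ) + 1))) ∧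
      (∀ s s' : List Bool, s.length = s'.length → s ≠ s' →
        Disjoint (closure (T s)) (closure (T s'))) := by
  choose A hA hAU hAs hAd using fun (n : ℕ) (V : {V : Set X // IsOpen V ∧ f '' V = univ}) =>
    split_small hY f hf hopen hdense (1 / ((n : ℝ) + 1)) (by positivity) V.1 V.2
  let T : List Bool → {V : Set X // IsOpen V ∧ f '' V = univ} := fun s =>
    List.rec ⟨U, hU⟩ (fun b s V => ⟨A s.length V b, hA s.length V b⟩) s
  have hT : ∀ b s, (T (b :: s)).1 = A s.length (T s) b := fun b s => rfl
  refine ⟨fun s => (T s).1, rfl, fun s => (T s).2.2, ?_, ?_, ?_⟩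
  · intro b s; exact hAU s.length (T s) b
  · intro b s; exact hAs s.length (T s) b
  · intro s
    induction s with
    | nil =>
      intro s' h hne
      exact absurd (List.length_eq_zero_iff.mp h.symm).symm hne
    | cons b s ih =>
      intro s' h hne
      cases s' with
      | nil => simp at h
      | cons b' s' =>
        by_cases hs : s = s'
        · subst hs
          have hb : b ≠ b' := by rintro rfl; exact hne rfl
          cases b <;> cases b'
          · exact absurd rfl hb
          · exact hAd s.length (T s)
          · exact (hAd s.length (T s)).symm
          · exact absurd rfl hb
        · have := ih s' (by simpa using h) hs
          exact this.mono ((by rw [hT]; exact hAU _ _ _ : closure (T (b :: s)).1 ⊆ _).trans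
            subset_closure) ((by rw [hT]; exact hAU _ _ _ : closure (T (b' :: s')).1 ⊆ _).trans
            subset_closure)

/-- The initial segment of `σ` of length `n`, reversed. -/
def pre (σ : ℕ → Bool) : ℕ → List Bool
  | 0 => []
  | n + 1 => σ n :: pre σ n

lemma pre_length (σ : ℕ → Bool) (n : ℕ) : (pre σ n).length = n := by
  induction n with
  | zero => rfl
  | succ n ih => simp [pre, ih]

theorem statement9 {X Y : Type*} [MetricSpace X]
    [TopologicalSpace Y] [T2Space Y] [ParacompactSpace Y] (hY : IsCSpace Y)
    (f : X → Y) (hf : Continuous f) (hopen : IsOpenMap f) (hsurj : Function.Surjective f)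
    (hdense : ∀ y : Y, ∀ x ∈ f ⁻¹' {y}, AccPt x (𝓟 (f ⁻¹' {y})))
    (hcompl : ∀ y : Y, IsComplete (f ⁻¹' {y}))
    (U : Set X) (hU : IsOpen U) (hUsec : f '' U = Set.univ) :
    ∃ (g : X → Y × unitInterval) (H : Set X) (C : Set unitInterval),
      Continuous g ∧ Function.Surjective g ∧
      IsClosed H ∧ H ⊆ U ∧ f '' H = Set.univ ∧
      Nonempty (↥C ≃ₜ (ℕ → Bool)) ∧
      (∀ x, (g x).1 = f x) ∧
      g '' H = Set.univ ∧
      (∀ y : Y, ∀ c ∈ C,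
        IsCompact (g ⁻¹' {(y, c)} ∩ H) ∧ CovDimZero ↥(g ⁻¹' {(y, c)} ∩ H)) ∧
      (IsClosed (H ∩ g ⁻¹' (Set.univ ×ˢ C)) ∧
        f '' (H ∩ g ⁻¹' (Set.univ ×ˢ C)) = Set.univ ∧
        ∀ y : Y, IsCompact ((H ∩ g ⁻¹' (Set.univ ×ˢ C)) ∩ f ⁻¹' {y}) ∧
          CovDimZero ↥((H ∩ g ⁻¹' (Set.univ ×ˢ C)) ∩ f ⁻¹' {y})) := by
  classical
  obtain ⟨T, hT0, hTsec, hTsub, hTsmall, hTdisj⟩ := exists_tree hY f hf hopen hdense U ⟨hU, hUsec⟩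
  have hfinl : ∀ n, {s : List Bool | s.length = n}.Finite := fun n => List.finite_length_eq Bool n
  let L : ℕ → Set X := fun n => ⋃ s ∈ {s : List Bool | s.length = n + 1}, closure (T s)
  have hLcl : ∀ n, IsClosed (L n) := fun n =>
    (hfinl (n + 1)).isClosed_biUnion fun s _ => isClosed_closure
  let H : Set X := ⋂ n, L n
  have hHcl : IsClosed H := isClosed_iInter hLcl
  have hHU : H ⊆ U := by
    intro x hx
    obtain ⟨s, hs, hxs⟩ := mem_iUnion₂.mp (mem_iInter.mp hx 0)
    obtain ⟨b, rfl⟩ := List.length_eq_one_iff.mp (mem_ofPred.mp hs)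
    rw [← hT0]
    exact hTsub b [] hxs
  -- compactness of the fibers of `H`
  have hcpt : ∀ y, IsCompact (H ∩ f ⁻¹' {y}) := by
    intro y
    rw [isCompact_iff_ultrafilter_le_nhds']
    intro 𝒰 h𝒰
    obtain ⟨x, hx, hle⟩ := ultrafilter_conv 𝒰 _ (hcompl y)
      (mem_of_superset h𝒰 inter_subset_right) (by
        intro ε hε
        obtain ⟨n, hn⟩ := exists_nat_one_div_lt hε
        have hch : ∀ s : List Bool, ∃ 𝒟 : Set (Set X), s.length = n + 1 → 𝒟.Finite ∧
            (∀ D ∈ 𝒟, ∀ a ∈ D, ∀ b ∈ D, dist a b ≤ ε) ∧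
            closure (T s) ∩ f ⁻¹' {y} ⊆ ⋃₀ 𝒟 := by
          intro s
          cases s with
          | nil => exact ⟨∅, by simp⟩
          | cons b s =>
            obtain ⟨𝒟, h1, -, -, h4, h5⟩ := hTsmall b s y
            refine ⟨𝒟, fun hs => ⟨h1, fun D hD a ha b hb => (h4 D hD a ha b hb).trans ?_, h5⟩⟩
            have : s.length = n := by simpa using hs
            rw [this]
            exact hn.le
        choose 𝒟 h𝒟 using hch
        refine ⟨⋃ s ∈ {s : List Bool | s.length = n + 1}, 𝒟 s,
          (hfinl (n + 1)).biUnion fun s hs => (h𝒟 s hs).1, ?_, ?_⟩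
        · intro D hD
          obtain ⟨s, hs, hDs⟩ := mem_iUnion₂.mp hD
          exact (h𝒟 s hs).2.1 D hDs
        · refine mem_of_superset h𝒰 ?_
          rintro x ⟨hx, hxy⟩
          obtain ⟨s, hs, hxs⟩ := mem_iUnion₂.mp (mem_iInter.mp hx n)
          obtain ⟨D, hD, hxD⟩ := (h𝒟 s hs).2.2 ⟨hxs, hxy⟩
          exact ⟨D, mem_iUnion₂.mpr ⟨s, hs, hD⟩, hxD⟩)
    refine ⟨x, ⟨?_, hx⟩, hle⟩
    exact isClosed_iff_ultrafilter.mp hHcl x 𝒰 hle (mem_of_superset h𝒰 inter_subset_left)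
  -- total disconnectedness of the fibers of `H`
  have htd : ∀ y, IsTotallyDisconnected (H ∩ f ⁻¹' {y}) := by
    intro y t ht hpc a ha b hb
    by_contra hab
    have hdpos : 0 < dist a b := dist_pos.mpr hab
    obtain ⟨n, hn⟩ := exists_nat_one_div_lt hdpos
    obtain ⟨s, hs, hts⟩ := preconn_finite hpc ⟨a, ha⟩ {s : List Bool | s.length = n + 1}
      (fun s => closure (T s)) (hfinl (n + 1)) (fun s _ => isClosed_closure)
      (fun s hs s' hs' hne => hTdisj s s'
        ((mem_ofPred.mp hs).trans (mem_ofPred.mp hs').symm) hne)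
      (fun x hx => mem_iInter.mp (ht hx).1 n)
    cases s with
    | nil => simp at hs
    | cons c s =>
      obtain ⟨𝒟, h1, h2, h3, h4, h5⟩ := hTsmall c s y
      obtain ⟨D, hD, htD⟩ := preconn_finite hpc ⟨a, ha⟩ 𝒟 id h1 h2 h3 (by
        intro x hx
        obtain ⟨D, hD, hxD⟩ := h5 ⟨hts hx, (ht hx).2⟩
        exact mem_iUnion₂.mpr ⟨D, hD, hxD⟩)
      have h6 := h4 D hD a (htD ha) b (htD hb)
      have : s.length = n := by simpa using hs
      rw [this] at h6
      linarith
  -- every branch is nonempty in every fiber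
  have hbranch : ∀ y (σ : ℕ → Bool), ∃ x, f x = y ∧ ∀ n, x ∈ closure (T (pre σ (n + 1))) := by
    intro y σ
    let K : ℕ → Set X := fun n => closure (T (pre σ (n + 1))) ∩ f ⁻¹' {y}
    have hKne : ∀ n, (K n).Nonempty := by
      intro n
      have : y ∈ f '' (T (pre σ (n + 1))) := by rw [hTsec]; trivial
      obtain ⟨x, hx, hxy⟩ := this
      exact ⟨x, subset_closure hx, hxy⟩
    have hKanti : Antitone K := by
      refine antitone_nat_of_succ_le fun n => ?_
      refine inter_subset_inter_left _ ?_
      exact (hTsub (σ (n + 1)) (pre σ (n + 1))).trans subset_closure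
    have hne : (⨅ n, 𝓟 (K n)).NeBot := by
      refine Filter.iInf_neBot_of_directed' (Antitone.directed_ge ?_) ?_
      · intro a b hab; exact principal_mono.mpr (hKanti hab)
      · intro n; exact principal_neBot_iff.mpr (hKne n)
    have hle := Ultrafilter.of_le (⨅ n, 𝓟 (K n))
    set 𝒰 := Ultrafilter.of (⨅ n, 𝓟 (K n))
    have hK𝒰 : ∀ n, K n ∈ 𝒰 := fun n =>
      hle (mem_iInf_of_mem n (mem_principal_self _))
    obtain ⟨x, hx, hle⟩ := ultrafilter_conv 𝒰 _ (hcompl y)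
      (mem_of_superset (hK𝒰 0) inter_subset_right) (by
        intro ε hε
        obtain ⟨n, hn⟩ := exists_nat_one_div_lt hε
        obtain ⟨𝒟, h1, -, -, h4, h5⟩ := hTsmall (σ n) (pre σ n) y
        rw [pre_length] at h4
        exact ⟨𝒟, h1, fun D hD a ha b hb => (h4 D hD a ha b hb).trans hn.le,
          mem_of_superset (hK𝒰 n) h5⟩)
    refine ⟨x, hx, fun n => ?_⟩
    exact isClosed_iff_ultrafilter.mp isClosed_closure x 𝒰 hle
      (mem_of_superset (hK𝒰 n) inter_subset_left)
  -- the digit functions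
  have hp : ∀ n, ∃ p : C(X, ℝ), (∀ x, p x ∈ Icc (0 : ℝ) 1) ∧
      ∀ s : List Bool, s.length = n → (∀ x ∈ closure (T (false :: s)), p x = 0) ∧
        ∀ x ∈ closure (T (true :: s)), p x = 1 := by
    intro n
    obtain ⟨p, h0, h1, h2⟩ := exists_continuous_zero_one_of_isClosed
      (s := ⋃ s ∈ {s : List Bool | s.length = n}, closure (T (false :: s)))
      (t := ⋃ s ∈ {s : List Bool | s.length = n}, closure (T (true :: s)))
      ((hfinl n).isClosed_biUnion fun s _ => isClosed_closure)
      ((hfinl n).isClosed_biUnion fun s _ => isClosed_closure) (by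
        rw [Set.disjoint_iUnion₂_left]
        intro s hs
        rw [Set.disjoint_iUnion₂_right]
        intro s' hs'
        refine hTdisj _ _ ?_ (by simp)
        simp [mem_ofPred.mp hs, mem_ofPred.mp hs'])
    exact ⟨p, h2, fun s hs => ⟨fun x hx => h0 (mem_iUnion₂.mpr ⟨s, hs, hx⟩),
      fun x hx => h1 (mem_iUnion₂.mpr ⟨s, hs, hx⟩)⟩⟩
  choose p hp01 hp using hp
  let h : X → ℝ := fun x => ∑' n, p n x * (2 ^ (n + 1))⁻¹
  have hgeo : HasSum (fun n : ℕ => ((2 : ℝ) ^ (n + 1))⁻¹) 1 := by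
    have := hasSum_geometric_two' 1
    convert this using 2 with n
    rw [pow_succ]
    field_simp
  have hbd : ∀ n x, ‖p n x * ((2 : ℝ) ^ (n + 1))⁻¹‖ ≤ ((2 : ℝ) ^ (n + 1))⁻¹ := by
    intro n x
    have := hp01 n x
    rw [norm_mul, Real.norm_of_nonneg this.1, Real.norm_of_nonneg (by positivity)]
    exact mul_le_of_le_one_left (by positivity) this.2
  have hhc : Continuous h :=
    continuous_tsum (fun n => (p n).continuous.mul continuous_const) hgeo.summable hbd
  have hh01 : ∀ x, h x ∈ Icc (0 : ℝ) 1 := by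
    intro x
    refine ⟨tsum_nonneg fun n => mul_nonneg (hp01 n x).1 (by positivity), ?_⟩
    rw [← hgeo.tsum_eq]
    refine Summable.tsum_le_tsum (fun n => ?_) (hgeo.summable.of_norm_bounded (fun n => hbd n x))
      hgeo.summable
    exact mul_le_of_le_one_left (by positivity) (hp01 n x).2
  let g : X → Y × unitInterval := fun x => (f x, ⟨h x, hh01 x⟩)
  have hgc : Continuous g := hf.prodMk (hhc.subtype_mk _)
  have hgH : g '' H = univ := by
    refine eq_univ_of_forall ?_
    rintro ⟨y, t⟩
    obtain ⟨d, -, hd⟩ := Real.ofDigits_SurjOn (b := 2) one_lt_two t.2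
    let σ : ℕ → Bool := fun n => decide (d n = 1)
    obtain ⟨x, hxy, hx⟩ := hbranch y σ
    refine ⟨x, mem_iInter.mpr fun n => mem_iUnion₂.mpr ⟨_, pre_length σ (n + 1), hx n⟩, ?_⟩
    refine Prod.ext hxy (Subtype.ext ?_)
    rw [← hd]
    refine tsum_congr fun n => ?_
    have hpx := hp n (pre σ n) (pre_length σ n)
    have hxn := hx n
    rw [pre] at hxn
    have hdn : d n = 0 ∨ d n = 1 := by
      generalize d n = e
      revert e
      decide
    rcases hdn with h0 | h1
    · have : σ n = false := by simp [σ, h0]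
      rw [this] at hxn
      simp [Real.ofDigitsTerm, hpx.1 x hxn, h0]
    · have : σ n = true := by simp [σ, h1]
      rw [this] at hxn
      simp [Real.ofDigitsTerm, hpx.2 x hxn, h1]
  let C : Set unitInterval := Subtype.val ⁻¹' cantorSet
  have hCcl : IsClosed C := isClosed_cantorSet.preimage continuous_subtype_val
  have hgmem : ∀ z : Y × unitInterval, ∃ x ∈ H, g x = z := by
    intro z
    have : z ∈ g '' H := by rw [hgH]; trivial
    exact this
  have hsub : ∀ y (K : Set X), IsClosed K → K ⊆ H ∩ f ⁻¹' {y} → IsCompact K ∧ CovDimZero ↥K := by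
    intro y K hK hKs
    have hKc := (hcpt y).of_isClosed_subset hK hKs
    exact ⟨hKc, covDimZero_of_compact hKc (fun t ht => htd y t (ht.trans hKs))⟩
  have hclfib : ∀ y, IsClosed (f ⁻¹' {y}) := fun y => isClosed_singleton.preimage hf
  have hHC : IsClosed (H ∩ g ⁻¹' (Set.univ ×ˢ C)) :=
    hHcl.inter ((isClosed_univ.prod hCcl).preimage hgc)
  refine ⟨g, H, C, hgc, fun z => ?_, hHcl, hHU, ?_, ?_, fun x => rfl, hgH, ?_, hHC, ?_, ?_⟩
  · obtain ⟨x, -, hx⟩ := hgmem z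
    exact ⟨x, hx⟩
  · refine eq_univ_of_forall fun y => ?_
    obtain ⟨x, hx, hxy⟩ := hgmem (y, 0)
    exact ⟨x, hx, congrArg Prod.fst hxy⟩
  · have e : C ≃ₜ cantorSet :=
      { toFun := fun c => ⟨c.1.1, c.2⟩
        invFun := fun c => ⟨⟨c.1, cantorSet_subset_unitInterval c.2⟩, c.2⟩
        left_inv := fun c => rfl
        right_inv := fun c => rfl
        continuous_toFun := by fun_prop
        continuous_invFun := by fun_prop }
    exact ⟨e.trans cantorSetHomeomorphNatToBool⟩
  · intro y c hc
    have : IsClosed (g ⁻¹' {(y, c)} ∩ H) := (isClosed_singleton.preimage hgc).inter hHcl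
    refine hsub y _ this ?_
    rintro x ⟨hx, hxH⟩
    exact ⟨hxH, congrArg Prod.fst (mem_singleton_iff.mp hx)⟩
  · refine eq_univ_of_forall fun y => ?_
    obtain ⟨x, hx, hxy⟩ := hgmem (y, 0)
    refine ⟨x, ⟨hx, ?_⟩, congrArg Prod.fst hxy⟩
    rw [mem_preimage, hxy]
    exact ⟨trivial, zero_mem_cantorSet⟩
  · intro y
    refine hsub y _ (hHC.inter (hclfib y)) ?_
    rintro x ⟨⟨hx, -⟩, hxy⟩
    exact ⟨hx, hxy⟩
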